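/- Let 0 < q < 1, p = 1 - q, and let Y be geometric with P(Y = j) = p q^j for j ≥ 0. Then the generalized Stirling numbers associated to Y+1 satisfy S_{Y+1}(n,m) = (1/q^m) ∑_{r=m}^{n} C(r,m) ⟨m⟩_{r-m} S(n,r) (q/p)^r for m ≤ n, where S_{Y+1}(n,m) = (1/m!) ∑_{k=0}^{m} C(m,k)(-1)^{m-k} E[(S_k + k)^n] and S_k is the sum of k independent copies of Y. -/

import Mathlib

open Finset

/-- The Stirling number of the second kind, defined by
`S(n,m) = (1/m!) ∑_{k=0}^{m} C(m,k) (-1)^{m-k} k^n`. -/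
noncomputable def stirling2 (n m : ℕ) : ℝ :=
  ((m.factorial : ℝ))⁻¹ * ∑ k ∈ range (m + 1), (m.choose k : ℝ) * (-1) ^ (m - k) * (k : ℝ) ^ n

/-- The rising factorial `⟨x⟩_n = x (x+1) ⋯ (x+n-1)` of a real number. -/
def risingFactorial (x : ℝ) (n : ℕ) : ℝ := ∏ i ∈ range n, (x + i)

/-- Newton's expansion of a power of a natural number in binomial coefficients. -/
theorem pow_eq_sum_choose_mul_stirling2 (n x : ℕ) :
    (x : ℝ) ^ n = ∑ r ∈ range (n + 1), (x.choose r : ℝ) * ((r.factorial : ℝ) * stirling2 n r) := by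
  have key (r : ℕ) :
      (fwdDiff (1 : ℝ))^[r] (fun y : ℝ ↦ y ^ n) 0 = (r.factorial : ℝ) * stirling2 n r := by
    rw [fwdDiff_iter_eq_sum_shift, stirling2, mul_inv_cancel_left₀ (by positivity)]
    refine sum_congr rfl fun k _ ↦ ?_
    simp [mul_comm]
  have hx := shift_eq_sum_fwdDiff_iter (1 : ℝ) (fun y : ℝ ↦ y ^ n) x 0
  simp only [key, zero_add, nsmul_eq_mul, mul_one] at hx
  rw [hx]
  have hvan (r : ℕ) (hr : n < r) : (r.factorial : ℝ) * stirling2 n r = 0 := by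
    rw [← key r]
    exact congrFun (fwdDiff_iter_pow_eq_zero_of_lt hr) 0
  rcases le_total x n with hxn | hxn
  · refine sum_subset (range_subset_range.2 (by omega)) fun r _ hr ↦ ?_
    rw [Nat.choose_eq_zero_of_lt (by simpa using hr)]
    simp
  · refine (sum_subset (range_subset_range.2 (by omega)) fun r _ hr ↦ ?_).symm
    rw [hvan r (by simpa using hr), mul_zero]

theorem summable_succ_choose_mul_geometric {q : ℝ} (hq0 : 0 < q) (hq1 : q < 1) (r : ℕ) :
    Summable fun j : ℕ ↦ ((j + 1).choose r : ℝ) * q ^ j := by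
  have h0 := summable_choose_mul_geometric_of_norm_lt_one r
    (show ‖q‖ < 1 by rwa [Real.norm_of_nonneg hq0.le])
  have h1 := (summable_nat_add_iff (f := fun j : ℕ ↦ ((j + r).choose r : ℝ) * q ^ j) 1).2 h0
  refine (h1.mul_right q⁻¹).of_nonneg_of_le (fun j ↦ by positivity) fun j ↦ ?_
  rw [pow_succ, mul_assoc, mul_assoc, mul_inv_cancel₀ hq0.ne', mul_one]
  exact mul_le_mul_of_nonneg_right (mod_cast Nat.choose_le_choose r (by omega)) (by positivity)

/-- The generating function, in the variable `X = t - 1`, of the binomial moments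
`E[C(Y + 1, r)]` for `Y` geometric with parameter `1 - q`. -/
noncomputable def geometricBinomialMoments (q : ℝ) : PowerSeries ℝ :=
  PowerSeries.mk fun r ↦ ∑' j : ℕ, ((j + 1).choose r : ℝ) * ((1 - q) * q ^ j)

theorem hasSum_geometricBinomialMoments {q : ℝ} (hq0 : 0 < q) (hq1 : q < 1) (r : ℕ) :
    HasSum (fun j : ℕ ↦ ((j + 1).choose r : ℝ) * ((1 - q) * q ^ j))
      (PowerSeries.coeff r (geometricBinomialMoments q)) := by
  rw [geometricBinomialMoments, PowerSeries.coeff_mk]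
  refine Summable.hasSum ?_
  simpa only [mul_left_comm] using (summable_succ_choose_mul_geometric hq0 hq1 r).mul_left (1 - q)

theorem coeff_zero_geometricBinomialMoments {q : ℝ} (hq0 : 0 < q) (hq1 : q < 1) :
    PowerSeries.coeff 0 (geometricBinomialMoments q) = 1 := by
  refine (hasSum_geometricBinomialMoments hq0 hq1 0).unique ?_
  have := (hasSum_geometric_of_lt_one hq0.le hq1).mul_left (1 - q)
  rw [mul_inv_cancel₀ (by linarith)] at this
  simpa using this

theorem coeff_succ_geometricBinomialMoments {q : ℝ} (hq0 : 0 < q) (hq1 : q < 1) (r : ℕ) :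
    (1 - q) * PowerSeries.coeff (r + 1) (geometricBinomialMoments q) =
      (1 - q) * (Nat.choose 1 (r + 1) : ℝ) +
        q * PowerSeries.coeff r (geometricBinomialMoments q) := by
  have h0 := hasSum_geometricBinomialMoments hq0 hq1 r
  have h1 := hasSum_geometricBinomialMoments hq0 hq1 (r + 1)
  have h2 := (hasSum_nat_add_iff' 1).2 h1
  have h3 := h2.unique (((h0.add h1).mul_left q).congr_fun fun j ↦ by
    rw [Nat.choose_succ_succ' (j + 1) r]
    push_cast
    ring)
  simp only [sum_range_one, zero_add, pow_zero, mul_one] at h3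
  linear_combination h3

theorem geometricBinomialMoments_sub_one_mul {q : ℝ} (hq0 : 0 < q) (hq1 : q < 1) :
    (geometricBinomialMoments q - 1) *
      (1 - PowerSeries.C (q / (1 - q)) * PowerSeries.X) =
      PowerSeries.C (1 - q)⁻¹ * PowerSeries.X := by
  have hp : 1 - q ≠ 0 := by linarith
  have h0 := coeff_zero_geometricBinomialMoments hq0 hq1
  ext r
  rw [mul_sub, mul_one, mul_left_comm, map_sub, PowerSeries.coeff_C_mul, PowerSeries.coeff_C_mul]
  rcases r with _ | r
  · rw [PowerSeries.coeff_zero_eq_constantCoeff_apply] at h0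
    simp [h0]
  have h1 := coeff_succ_geometricBinomialMoments hq0 hq1 r
  rw [PowerSeries.coeff_succ_mul_X, map_sub, map_sub, PowerSeries.coeff_one, PowerSeries.coeff_one,
    PowerSeries.coeff_X]
  rcases r with _ | r
  · simp only [h0] at h1 ⊢
    simp at h1 ⊢
    field_simp
    linarith
  · rw [Nat.choose_eq_zero_of_lt (by omega)] at h1
    simp at h1 ⊢
    field_simp
    linarith

theorem risingFactorial_succ_add (m j : ℕ) :
    risingFactorial ((m : ℝ) + 1) (j + 1) =
      risingFactorial m (j + 1) + (j + 1) * risingFactorial ((m : ℝ) + 1) j := by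
  have h : risingFactorial (m : ℝ) (j + 1) = m * risingFactorial ((m : ℝ) + 1) j := by
    rw [risingFactorial, prod_range_succ', risingFactorial, mul_comm]
    push_cast
    simp only [add_zero]
    congr 1
    exact prod_congr rfl fun i _ ↦ by ring
  rw [h, risingFactorial, prod_range_succ, ← risingFactorial]
  ring

/-- The binomial series of `(1 - c X)⁻ᵐ`. -/
noncomputable def negativeBinomialSeries (c : ℝ) (m : ℕ) : PowerSeries ℝ :=
  PowerSeries.mk fun j ↦ risingFactorial m j / (j.factorial : ℝ) * c ^ j

theorem negativeBinomialSeries_succ_mul (c : ℝ) (m : ℕ) :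
    negativeBinomialSeries c (m + 1) * (1 - PowerSeries.C c * PowerSeries.X) =
      negativeBinomialSeries c m := by
  ext j
  rw [mul_sub, mul_one, mul_left_comm, map_sub, PowerSeries.coeff_C_mul]
  rcases j with _ | j
  · simp [negativeBinomialSeries, risingFactorial]
  · simp only [PowerSeries.coeff_succ_mul_X, negativeBinomialSeries, PowerSeries.coeff_mk,
      Nat.factorial_succ]
    push_cast
    rw [risingFactorial_succ_add]
    field_simp
    ring

theorem negativeBinomialSeries_mul_pow (c : ℝ) (m : ℕ) :
    negativeBinomialSeries c m * (1 - PowerSeries.C c * PowerSeries.X) ^ m = 1 := by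
  induction m with
  | zero =>
    ext j
    rcases j with _ | j <;>
      simp [negativeBinomialSeries, risingFactorial, prod_range_succ', PowerSeries.coeff_one]
  | succ m ih => rw [pow_succ', ← mul_assoc, negativeBinomialSeries_succ_mul, ih]

theorem geometricBinomialMoments_sub_one_pow {q : ℝ} (hq0 : 0 < q) (hq1 : q < 1) (m : ℕ) :
    (geometricBinomialMoments q - 1) ^ m =
      PowerSeries.C ((1 - q)⁻¹ ^ m) *
        (PowerSeries.X ^ m * negativeBinomialSeries (q / (1 - q)) m) := by
  have h1 := congrArg (· ^ m) (geometricBinomialMoments_sub_one_mul hq0 hq1)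
  have h2 := negativeBinomialSeries_mul_pow (q / (1 - q)) m
  simp only [mul_pow] at h1
  rw [map_pow]
  linear_combination negativeBinomialSeries (q / (1 - q)) m * h1 -
    (geometricBinomialMoments q - 1) ^ m * h2

/-- The binomial moments of a sum of `k` independent copies of `Y + 1`, with `Y` geometric. -/
theorem hasSum_choose_sum_geometric {q : ℝ} (hq0 : 0 < q) (hq1 : q < 1) (k r : ℕ) :
    HasSum (fun a : Fin k → ℕ ↦ ((∑ i, (a i + 1)).choose r : ℝ) * ∏ i, (1 - q) * q ^ a i)
      (PowerSeries.coeff r (geometricBinomialMoments q ^ k)) := by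
  have hp : 0 ≤ 1 - q := by linarith
  induction k generalizing r with
  | zero =>
    convert hasSum_unique (fun a : Fin 0 → ℕ ↦
      ((∑ i, (a i + 1)).choose r : ℝ) * ∏ i, (1 - q) * q ^ a i) using 1
    rcases r with _ | r <;> simp [PowerSeries.coeff_one]
  | succ k ih =>
    rw [← (Fin.consEquiv fun _ ↦ ℕ).hasSum_iff, pow_succ', PowerSeries.coeff_mul]
    have hmul (i j : ℕ) := (hasSum_geometricBinomialMoments hq0 hq1 i).mul (ih j)
      ((hasSum_geometricBinomialMoments hq0 hq1 i).summable.mul_of_nonneg (ih j).summable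
        (fun _ ↦ mul_nonneg (by positivity) (by positivity))
        (fun _ ↦ mul_nonneg (by positivity) (prod_nonneg fun _ _ ↦ by positivity)))
    refine (hasSum_sum (s := antidiagonal r) fun ij _ ↦ hmul ij.1 ij.2).congr_fun fun x ↦ ?_
    simp only [Function.comp_apply, Fin.consEquiv_apply, Fin.sum_univ_succ, Fin.prod_univ_succ,
      Fin.cons_zero, Fin.cons_succ, Nat.add_choose_eq]
    push_cast
    rw [sum_mul]
    exact sum_congr rfl fun ij _ ↦ by ring

/-- The moments of a sum of `k` independent copies of `Y + 1`, with `Y` geometric. -/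
theorem tsum_pow_sum_geometric {q : ℝ} (hq0 : 0 < q) (hq1 : q < 1) (k n : ℕ) :
    ∑' a : Fin k → ℕ, (∑ i, ((a i : ℝ) + 1)) ^ n * ∏ i, (1 - q) * q ^ a i =
      ∑ r ∈ range (n + 1), (r.factorial : ℝ) * stirling2 n r *
        PowerSeries.coeff r (geometricBinomialMoments q ^ k) := by
  refine ((hasSum_sum fun r _ ↦ (hasSum_choose_sum_geometric hq0 hq1 k r).mul_left
    ((r.factorial : ℝ) * stirling2 n r)).congr_fun fun a ↦ ?_).tsum_eq
  have h := pow_eq_sum_choose_mul_stirling2 n (∑ i, (a i + 1))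
  push_cast at h
  rw [h, sum_mul]
  exact sum_congr rfl fun r _ ↦ by ring

theorem sum_choose_mul_coeff_pow (F : PowerSeries ℝ) (m r : ℕ) :
    ∑ k ∈ range (m + 1), (m.choose k : ℝ) * (-1) ^ (m - k) * PowerSeries.coeff r (F ^ k) =
      PowerSeries.coeff r ((F - 1) ^ m) := by
  rw [sub_eq_add_neg, add_pow, map_sum]
  refine sum_congr rfl fun k _ ↦ ?_
  have : F ^ k * (-1) ^ (m - k) * (m.choose k : PowerSeries ℝ) =
      PowerSeries.C ((m.choose k : ℝ) * (-1) ^ (m - k)) * F ^ k := by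
    simp only [map_mul, map_pow, map_neg, map_one, map_natCast]
    ring
  rw [this, PowerSeries.coeff_C_mul]

/-- For `Y` geometric with `P(Y = j) = p q^j` on `{0,1,2,…}` (`0 < q < 1`, `p = 1 - q`),
the generalized Stirling numbers associated to `Y + 1` satisfy
`S_{Y+1}(n,m) = (1/q^m) ∑_{r=m}^{n} C(r,m) ⟨m⟩_{r-m} S(n,r) (q/p)^r` for `m ≤ n`, where
`S_{Y+1}(n,m) = (1/m!) ∑_{k=0}^{m} C(m,k) (-1)^{m-k} E[(S_k + k)^n]` and the expectation
`E[(S_k + k)^n]` is written as the sum over the values of `k` independent copies of `Y`. -/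
theorem generalized_stirling_geometric (q p : ℝ) (hq0 : 0 < q) (hq1 : q < 1)
    (hp : p = 1 - q) (n m : ℕ) (h : m ≤ n) :
    ((m.factorial : ℝ))⁻¹ *
      ∑ k ∈ range (m + 1), (m.choose k : ℝ) * (-1) ^ (m - k) *
        (∑' a : Fin k → ℕ, (∑ i, ((a i : ℝ) + 1)) ^ n * ∏ i, p * q ^ (a i)) =
      (1 / q ^ m) *
        ∑ r ∈ Icc m n, (r.choose m : ℝ) * risingFactorial (m : ℝ) (r - m) *
          stirling2 n r * (q / p) ^ r := by
  subst hp
  have hp : 1 - q ≠ 0 := by linarith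
  simp_rw [tsum_pow_sum_geometric hq0 hq1, mul_sum]
  rw [sum_comm]
  have hcoeff (r : ℕ) : ∑ k ∈ range (m + 1), ((m.factorial : ℝ))⁻¹ *
      ((m.choose k : ℝ) * (-1) ^ (m - k) * ((r.factorial : ℝ) * stirling2 n r *
        PowerSeries.coeff r (geometricBinomialMoments q ^ k))) =
      ((m.factorial : ℝ))⁻¹ * ((r.factorial : ℝ) * stirling2 n r) *
        PowerSeries.coeff r ((geometricBinomialMoments q - 1) ^ m) := by
    rw [← sum_choose_mul_coeff_pow, mul_sum]
    exact sum_congr rfl fun k _ ↦ by ring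
  simp_rw [hcoeff, geometricBinomialMoments_sub_one_pow hq0 hq1, PowerSeries.coeff_C_mul,
    PowerSeries.coeff_X_pow_mul']
  symm
  refine sum_subset_zero_on_sdiff (fun r hr ↦ by simp at hr ⊢; omega) (fun r hr ↦ ?_)
    fun r hr ↦ ?_
  · rw [if_neg (by simp at hr; omega)]
    simp
  · obtain ⟨j, rfl⟩ := Nat.exists_eq_add_of_le (mem_Icc.1 hr).1
    rw [if_pos (by omega), negativeBinomialSeries, PowerSeries.coeff_mk, Nat.add_sub_cancel_left,
      Nat.cast_choose ℝ (by omega), Nat.add_sub_cancel_left, pow_add, div_pow q (1 - q) m, inv_pow]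
    field_simp
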